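/- arXiv:1804.07078 — 4 statements merged into one kernel-verified Lean document; each statement's English description precedes it below -/
import Mathlib

section
/- Let P be an arbitrary type of process identifiers and L a linear order of tags. Suppose the event list e = l₁ ++ (p, t) :: (q, u) :: l₂ is locally monotone and u < t. Then p ≠ q, and the list e' = l₁ ++ (q, u) :: (p, t) :: l₂ obtained by swapping the two adjacent elements is a permutation of e, is locally monotone, and has the same projection onto every process as e. This is the combinatorial content of the paper's swap Theorem (reducing Big-receive executions to monotonic executions): two adjacent actions whose tags are out of order must belong to distinct processes and can be exchanged without changing any process's local behavior. -/
/-- Swapping two adjacent out-of-order actions of a locally monotone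
event list: the two actions belong to distinct processes and the swapped list is a
locally monotone permutation with the same projection onto every process. -/
theorem swap_adjacent_out_of_order
    (P : Type*) [DecidableEq P] (L : Type*) [LinearOrder L]
    (l₁ l₂ : List (P × L)) (p q : P) (t u : L)
    (hmono : ∀ a : P,
      List.Pairwise (fun x y : P × L => x.2 ≤ y.2)
        ((l₁ ++ (p, t) :: (q, u) :: l₂).filter (fun x => x.1 = a)))
    (hlt : u < t) :
    p ≠ q ∧
    (l₁ ++ (q, u) :: (p, t) :: l₂).Perm (l₁ ++ (p, t) :: (q, u) :: l₂) ∧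
    (∀ a : P,
      List.Pairwise (fun x y : P × L => x.2 ≤ y.2)
        ((l₁ ++ (q, u) :: (p, t) :: l₂).filter (fun x => x.1 = a))) ∧
    (∀ a : P,
      (l₁ ++ (q, u) :: (p, t) :: l₂).filter (fun x => x.1 = a) =
        (l₁ ++ (p, t) :: (q, u) :: l₂).filter (fun x => x.1 = a)) := by
  have hpq : p ≠ q := by
    rintro rfl
    have h := hmono p
    simp only [List.filter_append, List.filter_cons, decide_true, if_true] at h
    have hle : t ≤ u :=
      (List.pairwise_cons.1 (List.pairwise_append.1 h).2.1).1 (p, u) List.mem_cons_self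
    exact absurd hlt hle.not_gt
  have hproj : ∀ a : P,
      (l₁ ++ (q, u) :: (p, t) :: l₂).filter (fun x => x.1 = a) =
        (l₁ ++ (p, t) :: (q, u) :: l₂).filter (fun x => x.1 = a) := by
    intro a
    by_cases hp : p = a
    · have hq : q ≠ a := fun h => hpq (hp.trans h.symm)
      simp [hp, hq]
    · simp [List.filter_cons, hp]
  exact ⟨hpq, (List.Perm.swap _ _ _).append_left _, fun a => hproj a ▸ hmono a, hproj⟩
end

section
/- Let E be a type, r : E → E → Prop an irreflexive and transitive relation, L a linear order, and f : E → L a map such that r x y implies f x ≤ f y. Define s x y := r x y ∨ f x < f y. Then the transitive closure of s is irreflexive: for every x, ¬ Relation.TransGen s x x. In other words, augmenting a happens-before order with all pairs of events whose tags are strictly increasing never creates a cycle; this acyclicity is what allows the paper to topologically sort an execution simultaneously by causality and by tag. -/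
/-- Augmenting a happens-before order with strict tag increase
never creates a cycle: the transitive closure of the augmented relation is
irreflexive. -/
theorem transGen_irrefl_of_monotone_tags
    (E : Type*) (r : E → E → Prop)
    (hirr : ∀ x, ¬ r x x) (htrans : ∀ x y z, r x y → r y z → r x z)
    (L : Type*) [LinearOrder L] (f : E → L)
    (hmono : ∀ x y, r x y → f x ≤ f y) :
    ∀ x : E, ¬ Relation.TransGen (fun x y => r x y ∨ f x < f y) x x := by
  intro x h
  have hs : IsTrans E (fun x y => r x y ∨ f x < f y) := by
    refine ⟨?_⟩
    rintro a b c (hab | hab) (hbc | hbc)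
    · exact Or.inl (htrans a b c hab hbc)
    · exact Or.inr ((hmono a b hab).trans_lt hbc)
    · exact Or.inr (hab.trans_le (hmono b c hbc))
    · exact Or.inr (hab.trans hbc)
  rw [Relation.transGen_eq_self] at h
  exact h.elim (hirr x) (lt_irrefl _)
end

section
/- Let P be an arbitrary type of process identifiers, and label each action of a round by a kind in Fin 3, where 0 stands for a send action, 1 for a receive action, and 2 for a local computation (update) action. If e : List (P × Fin 3) is locally monotone (for each process, its sequence of kinds is non-decreasing, i.e., the process first sends, then receives, then computes), then there exist lists s, r, u such that every element of s has kind 0, every element of r has kind 1, every element of u has kind 2, the concatenation s ++ r ++ u is a permutation of e, and s ++ r ++ u has the same projection onto every process as e. This is the combinatorial content of the paper's Proposition that every monotonic execution can be reordered into an indistinguishable send-receive-compute execution in which, within each round, all sends precede all receives, which precede all computations. -/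
/-- A list that is monotone in a `Fin 3`-valued label is the concatenation of its three
label classes. -/
theorem List.Pairwise.filter_append_filter_append_filter_eq {α : Type*} {f : α → Fin 3}
    {l : List α} (h : l.Pairwise (fun x y => f x ≤ f y)) :
    l.filter (fun x => f x = 0) ++ l.filter (fun x => f x = 1) ++
      l.filter (fun x => f x = 2) = l := by
  induction l with
  | nil => rfl
  | cons a l ih =>
    obtain ⟨ha, hl⟩ := List.pairwise_cons.1 h
    have filter_eq_nil {i : Fin 3} (hi : i < f a) : l.filter (fun x => f x = i) = [] := by
      simp only [List.filter_eq_nil_iff, decide_eq_true_eq]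
      exact fun x hx => (hi.trans_le (ha x hx)).ne'
    have ih := ih hl
    obtain h0 | h1 | h2 : f a = 0 ∨ f a = 1 ∨ f a = 2 := by lia
    · simpa [h0] using ih
    · simpa [h1, filter_eq_nil (i := 0) (by simp [h1])] using ih
    · simpa [h2, filter_eq_nil (i := 0) (by simp [h2]),
        filter_eq_nil (i := 1) (by simp [h2])] using ih

/-- Lists with the same projection onto every fibre of a function are permutations of each
other. -/
theorem List.perm_of_forall_filter_eq {α β : Type*} [DecidableEq β] {f : α → β}
    {l₁ l₂ : List α}
    (h : ∀ b, l₁.filter (fun x => f x = b) = l₂.filter (fun x => f x = b)) :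
    l₁.Perm l₂ := by
  classical
  refine List.perm_iff_count.2 fun a => ?_
  rw [← List.count_filter (p := fun x => f x = f a) (l := l₁) (by simp), h,
    List.count_filter (by simp)]


/-- Every locally monotone round execution (kinds 0 = send,
1 = receive, 2 = compute) can be reordered into a send-receive-compute execution
that is a permutation with the same projection onto every process. -/
theorem send_receive_compute_reordering
    (P : Type*) [DecidableEq P]
    (e : List (P × Fin 3))
    (hmono : ∀ p : P,
      List.Pairwise (fun x y : P × Fin 3 => x.2 ≤ y.2) (e.filter (fun x => x.1 = p))) :
    ∃ s r u : List (P × Fin 3),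
      (∀ x ∈ s, x.2 = (0 : Fin 3)) ∧
      (∀ x ∈ r, x.2 = (1 : Fin 3)) ∧
      (∀ x ∈ u, x.2 = (2 : Fin 3)) ∧
      (s ++ r ++ u).Perm e ∧
      ∀ p : P, (s ++ r ++ u).filter (fun x => x.1 = p) = e.filter (fun x => x.1 = p) := by
  have hproj (p : P) :
      (e.filter (fun x => x.2 = 0) ++ e.filter (fun x => x.2 = 1) ++
        e.filter (fun x => x.2 = 2)).filter (fun x => x.1 = p) =
      e.filter (fun x => x.1 = p) := by
    simp only [List.filter_append, List.filter_comm (fun x : P × Fin 3 => decide (x.1 = p))]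
    exact (hmono p).filter_append_filter_append_filter_eq
  exact ⟨_, _, _, by simp, by simp, by simp, List.perm_of_forall_filter_eq hproj, hproj⟩
end

section
/- Let E be a type of events and matches : E → E → Prop a relation where matches a b means that the send event a is the matching send of the receive event b. Call a duplicate-free list l : List E causally valid if for all a, b with matches a b, a ∈ l and b ∈ l, the event a occurs strictly before b in l (there exist l₁, l₂, l₃ with l = l₁ ++ a :: l₂ ++ b :: l₃). If l = l₁ ++ x :: y :: l₂ is a duplicate-free causally valid list and x is not the matching send of y (¬ matches x y), then the swapped list l₁ ++ y :: x :: l₂ is also causally valid. This is the core of the paper's mover argument (following Lipton): an action can be commuted past an adjacent later receive of another process, preserving the property that every receive occurs after its matching send. -/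
/-- A duplicate-free list is causally valid w.r.t. `matchesRel`: every matching send
occurs strictly before its receive. -/
def CausallyValid {E : Type*} (matchesRel : E → E → Prop) (l : List E) : Prop :=
  ∀ a b : E, matchesRel a b → a ∈ l → b ∈ l →
    ∃ l₁ l₂ l₃ : List E, l = l₁ ++ a :: l₂ ++ b :: l₃

section PairSublist

open scoped List

theorem List.pair_sublist_iff_exists_append {α : Type*} {a b : α} {l : List α} :
    [a, b] <+ l ↔ ∃ l₁ l₂ l₃ : List α, l = l₁ ++ a :: l₂ ++ b :: l₃ := by
  constructor
  · intro h
    obtain ⟨r₁, r₂, rfl, ha, hb⟩ := List.cons_sublist_iff.mp h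
    obtain ⟨s, t, rfl⟩ := List.append_of_mem ha
    obtain ⟨u, v, rfl⟩ := List.append_of_mem (List.singleton_sublist.mp hb)
    exact ⟨s, t ++ u, v, by simp⟩
  · rintro ⟨l₁, l₂, l₃, rfl⟩
    have ha : [a] <+ l₁ ++ a :: l₂ := by simp
    have hb : [b] <+ b :: l₃ := by simp
    exact ha.append hb

theorem List.pair_sublist_append_iff {α : Type*} {a b : α} {l r : List α} :
    [a, b] <+ l ++ r ↔ [a, b] <+ l ∨ a ∈ l ∧ b ∈ r ∨ [a, b] <+ r := by
  induction l with
  | nil => simp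
  | cons c l ih =>
    simp only [List.cons_append, List.sublist_cons_iff, ih, List.cons.injEq]
    grind

/-- Swapping two adjacent entries only affects the order of that pair. -/
theorem List.pair_sublist_swap {α : Type*} {a b x y : α} {l₁ l₂ : List α}
    (h : [a, b] <+ l₁ ++ x :: y :: l₂) :
    a = x ∧ b = y ∨ [a, b] <+ l₁ ++ y :: x :: l₂ := by
  rw [List.pair_sublist_append_iff] at h ⊢
  simp only [List.sublist_cons_iff, List.cons.injEq] at h ⊢
  grind

end PairSublist

/-- Commuting two adjacent events that are not a matching
send/receive pair preserves causal validity. -/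
theorem swap_preserves_causal_validity
    (E : Type*) (matchesRel : E → E → Prop)
    (l₁ l₂ : List E) (x y : E)
    (hnodup : (l₁ ++ x :: y :: l₂).Nodup)
    (hvalid : CausallyValid matchesRel (l₁ ++ x :: y :: l₂))
    (hnomatch : ¬ matchesRel x y) :
    CausallyValid matchesRel (l₁ ++ y :: x :: l₂) := by
  intro a b hab ha hb
  have hbefore := hvalid a b hab (by grind) (by grind)
  rw [← List.pair_sublist_iff_exists_append] at hbefore ⊢
  rcases List.pair_sublist_swap hbefore with ⟨rfl, rfl⟩ | h
  · exact absurd hab hnomatch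
  · exact h
end
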